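/- If the exponential family is minimal, then the forward map θ ↦ ∇A(θ) = (E_θ[φ_α(X)])_{α∈I} is a bijection from ℝ^I onto the interior of the set M_φ of realizable mean parameters (equivalently, onto the relative interior of the convex hull of {φ(x) : x ∈ X}, which coincides with its interior under minimality). -/

import Mathlib

/-- The log-partition function `A(θ) = log Σ_{x∈X} exp⟨θ, φ(x)⟩`. -/
noncomputable def logPartition {X I : Type*} [Fintype X] [Fintype I]
    (φ : X → I → ℝ) (θ : I → ℝ) : ℝ :=
  Real.log (∑ x : X, Real.exp (∑ α : I, θ α * φ x α))

/-- The exponential-family density `p_θ(x) = exp(⟨θ, φ(x)⟩ − A(θ))`. -/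
noncomputable def expDensity {X I : Type*} [Fintype X] [Fintype I]
    (φ : X → I → ℝ) (θ : I → ℝ) (x : X) : ℝ :=
  Real.exp ((∑ α : I, θ α * φ x α) - logPartition φ θ)

/-- The forward map `θ ↦ ∇A(θ) = (E_θ[φ_α(X)])_{α∈I}`. -/
noncomputable def forwardMap {X I : Type*} [Fintype X] [Fintype I]
    (φ : X → I → ℝ) (θ : I → ℝ) : I → ℝ :=
  fun α => ∑ x : X, φ x α * expDensity φ θ x

/-- The set `M_φ` of realizable mean parameters:
`M_φ = {μ : μ = Σ_{x∈X} φ(x) q(x) for some probability distribution q on X}`. -/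
def meanParamSet {X I : Type*} [Fintype X] [Fintype I] (φ : X → I → ℝ) : Set (I → ℝ) :=
  {μ | ∃ q : X → ℝ, (∀ x, 0 ≤ q x) ∧ (∑ x : X, q x = 1) ∧
    ∀ α : I, μ α = ∑ x : X, φ x α * q x}

/-- Minimality: no nonzero `a ∈ ℝ^I` and constant `c` satisfy
`⟨a, φ(x)⟩ = c` for all `x ∈ X`. -/
def MinimalFamily {X I : Type*} [Fintype I] (φ : X → I → ℝ) : Prop :=
  ¬ ∃ a : I → ℝ, a ≠ 0 ∧ ∃ c : ℝ, ∀ x : X, ∑ α : I, a α * φ x α = c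

section ExponentialFamily

variable {X I : Type*} [Fintype X] [Fintype I]

theorem sum_exp_pos [Nonempty X] (f : X → ℝ) : 0 < ∑ x : X, Real.exp (f x) :=
  Finset.sum_pos (fun _ _ => Real.exp_pos _) Finset.univ_nonempty

theorem expDensity_eq_div [Nonempty X] (φ : X → I → ℝ) (θ : I → ℝ) (x : X) :
    expDensity φ θ x =
      Real.exp (∑ α : I, θ α * φ x α) / ∑ y : X, Real.exp (∑ α : I, θ α * φ y α) := by
  rw [expDensity, Real.exp_sub, logPartition, Real.exp_log (sum_exp_pos _)]

theorem sum_expDensity [Nonempty X] (φ : X → I → ℝ) (θ : I → ℝ) :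
    ∑ x : X, expDensity φ θ x = 1 := by
  simp only [expDensity_eq_div]
  rw [← Finset.sum_div, div_self (sum_exp_pos _).ne']

theorem sum_mul_forwardMap (φ : X → I → ℝ) (θ a : I → ℝ) :
    ∑ α : I, a α * forwardMap φ θ α =
      ∑ x : X, (∑ α : I, a α * φ x α) * expDensity φ θ x := by
  simp only [forwardMap, Finset.mul_sum, Finset.sum_mul]
  rw [Finset.sum_comm]
  simp only [mul_assoc]

theorem sub_mul_exp_sub_exp_nonneg (u v : ℝ) : 0 ≤ (u - v) * (Real.exp u - Real.exp v) := by
  rcases le_total u v with h | h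
  · exact mul_nonneg_of_nonpos_of_nonpos (sub_nonpos.2 h) (sub_nonpos.2 (Real.exp_le_exp.2 h))
  · exact mul_nonneg (sub_nonneg.2 h) (sub_nonneg.2 (Real.exp_le_exp.2 h))

theorem MinimalFamily.forwardMap_injective [Nonempty X] {φ : X → I → ℝ}
    (hmin : MinimalFamily φ) : Function.Injective (forwardMap φ) := by
  intro θ η h
  by_contra hne
  refine hmin ⟨θ - η, sub_ne_zero.2 hne, logPartition φ θ - logPartition φ η, ?_⟩
  set u : X → ℝ := fun x => (∑ α : I, θ α * φ x α) - logPartition φ θ with hu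
  set v : X → ℝ := fun x => (∑ α : I, η α * φ x α) - logPartition φ η with hv
  have huv : ∀ x, u x - v x =
      (∑ α : I, (θ - η) α * φ x α) - (logPartition φ θ - logPartition φ η) := by
    intro x
    simp only [hu, hv, Pi.sub_apply, sub_mul, Finset.sum_sub_distrib]
    ring
  have hsum : ∑ x : X, (u x - v x) * (Real.exp (u x) - Real.exp (v x)) = 0 := by
    have h₁ := sum_mul_forwardMap φ θ (θ - η)
    have h₂ := sum_mul_forwardMap φ η (θ - η)
    have h₃ := sum_expDensity φ θ
    have h₄ := sum_expDensity φ η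
    rw [h] at h₁
    calc ∑ x : X, (u x - v x) * (Real.exp (u x) - Real.exp (v x))
        = ∑ x : X, ((∑ α : I, (θ - η) α * φ x α) - (logPartition φ θ - logPartition φ η)) *
            (expDensity φ θ x - expDensity φ η x) := by simp only [huv]; rfl
      _ = 0 := by
        simp only [sub_mul _ (logPartition φ θ - logPartition φ η), mul_sub _ (expDensity φ θ _),
          Finset.sum_sub_distrib, ← Finset.mul_sum]
        rw [← h₁, ← h₂, h₃, h₄]
        ring
  intro x
  have hx := (Finset.sum_eq_zero_iff_of_nonneg
    (fun x _ => sub_mul_exp_sub_exp_nonneg (u x) (v x))).1 hsum x (Finset.mem_univ x)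
  have huvx : u x = v x := by
    rcases mul_eq_zero.1 hx with h | h
    · exact sub_eq_zero.1 h
    · exact Real.exp_injective (sub_eq_zero.1 h)
  have := huv x
  linarith

/-- The linear map sending weights on `X` to their moment vector together with their total mass. -/
noncomputable def momentMassMap (φ : X → I → ℝ) : (X → ℝ) →ₗ[ℝ] (I → ℝ) × ℝ where
  toFun q := (fun α => ∑ x : X, φ x α * q x, ∑ x : X, q x)
  map_add' p q := by
    ext <;> simp [mul_add, Finset.sum_add_distrib]
  map_smul' c q := by
    ext <;> simp [Finset.mul_sum, mul_left_comm]

theorem MinimalFamily.momentMassMap_surjective [Nonempty X] {φ : X → I → ℝ}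
    (hmin : MinimalFamily φ) : Function.Surjective (momentMassMap φ) := by
  classical
  rw [← LinearMap.range_eq_top]
  by_contra hne
  obtain ⟨f, hf, hker⟩ := Submodule.exists_le_ker_of_lt_top _ (lt_top_iff_ne_top.2 hne)
  have hexp : ∀ (μ : I → ℝ) (s : ℝ),
      f (μ, s) = (∑ α : I, f (Pi.single α 1, 0) * μ α) + s * f (0, 1) := by
    intro μ s
    have h₁ : f (μ, 0) = ∑ α : I, f (Pi.single α 1, 0) * μ α := by
      have := LinearMap.pi_apply_eq_sum_univ (f ∘ₗ LinearMap.inl ℝ (I → ℝ) ℝ) μ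
      simp only [LinearMap.comp_apply, LinearMap.inl_apply, smul_eq_mul] at this
      rw [this]
      refine Finset.sum_congr rfl fun α _ => ?_
      rw [mul_comm]
      congr 3
      ext β
      simp [Pi.single_apply, eq_comm]
    have h₂ : f (0, s) = s * f (0, 1) := by
      rw [← smul_eq_mul, ← map_smul]
      simp
    rw [← h₁, ← h₂, ← map_add]
    simp
  have hφ : ∀ x, (∑ α : I, f (Pi.single α 1, 0) * φ x α) + f (0, 1) = 0 := by
    intro x
    have h₁ : momentMassMap φ (Pi.single x 1) = (φ x, 1) := by
      ext <;> simp [momentMassMap, Pi.single_apply]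
    have h₂ : f (φ x, 1) = 0 := hker ⟨_, h₁⟩
    rwa [hexp, one_mul] at h₂
  have ha : (fun α : I => f (Pi.single α 1, 0)) = 0 := by
    by_contra ha
    exact hmin ⟨_, ha, -f (0, 1), fun x => eq_neg_of_add_eq_zero_left (hφ x)⟩
  have ha' : ∀ α : I, f (Pi.single α 1, 0) = 0 := congrFun ha
  have hc : f (0, 1) = 0 := by
    simpa [ha'] using hφ (Classical.arbitrary X)
  apply hf
  refine LinearMap.ext fun z => ?_
  obtain ⟨μ, s⟩ := z
  rw [hexp, hc, Finset.sum_eq_zero fun α _ => by rw [ha', zero_mul]]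
  simp

theorem MinimalFamily.range_forwardMap_subset [Nonempty X] {φ : X → I → ℝ}
    (hmin : MinimalFamily φ) : Set.range (forwardMap φ) ⊆ interior (meanParamSet φ) := by
  rintro _ ⟨θ, rfl⟩
  have hopen : IsOpen (momentMassMap φ '' Set.univ.pi fun _ => Set.Ioi 0) :=
    (LinearMap.isOpenMap_of_finiteDimensional _ hmin.momentMassMap_surjective) _
      (isOpen_set_pi Set.finite_univ fun _ _ => isOpen_Ioi)
  have hslice := hopen.preimage (f := fun μ : I → ℝ => (μ, (1 : ℝ))) (by fun_prop)
  refine mem_interior.2 ⟨_, ?_, hslice, ?_⟩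
  · rintro μ ⟨q, hq, hqμ⟩
    have h₁ : (fun α => ∑ x : X, φ x α * q x) = μ := congrArg Prod.fst hqμ
    have h₂ : ∑ x : X, q x = 1 := congrArg Prod.snd hqμ
    exact ⟨q, fun x => (hq x trivial).le, h₂, fun α => (congrFun h₁ α).symm⟩
  · exact ⟨expDensity φ θ, fun x _ => Real.exp_pos _, Prod.ext rfl (sum_expDensity φ θ)⟩

theorem le_logPartition [Nonempty X] (φ : X → I → ℝ) (θ : I → ℝ) (x : X) :
    ∑ α : I, θ α * φ x α ≤ logPartition φ θ := by
  rw [logPartition, Real.le_log_iff_exp_le (sum_exp_pos _)]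
  exact Finset.single_le_sum (f := fun x => Real.exp (∑ α : I, θ α * φ x α))
    (fun _ _ => (Real.exp_pos _).le) (Finset.mem_univ x)

theorem le_logPartition_of_mem_meanParamSet [Nonempty X] {φ : X → I → ℝ} {μ : I → ℝ}
    (hμ : μ ∈ meanParamSet φ) (θ : I → ℝ) : ∑ α : I, θ α * μ α ≤ logPartition φ θ := by
  obtain ⟨q, hq, hq1, hqμ⟩ := hμ
  calc ∑ α : I, θ α * μ α = ∑ x : X, q x * ∑ α : I, θ α * φ x α := by
        simp only [hqμ, Finset.mul_sum]
        rw [Finset.sum_comm]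
        exact Finset.sum_congr rfl fun _ _ => Finset.sum_congr rfl fun _ _ => by ring
    _ ≤ ∑ x : X, q x * logPartition φ θ :=
        Finset.sum_le_sum fun x _ => mul_le_mul_of_nonneg_left (le_logPartition φ θ x) (hq x)
    _ = logPartition φ θ := by rw [← Finset.sum_mul, hq1, one_mul]

theorem exists_mul_norm_le_logPartition_sub [Nonempty X] {φ : X → I → ℝ} {μ : I → ℝ}
    (hμ : μ ∈ interior (meanParamSet φ)) :
    ∃ r > 0, ∀ θ : I → ℝ, r * ‖θ‖ ≤ logPartition φ θ - ∑ α : I, θ α * μ α := by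
  obtain ⟨r, hr, hball⟩ := Metric.nhds_basis_closedBall.mem_iff.1 (mem_interior_iff_mem_nhds.1 hμ)
  refine ⟨r, hr, fun θ => ?_⟩
  have hmem : (fun α => μ α + r * SignType.sign (θ α)) ∈ meanParamSet φ := by
    apply hball
    rw [Metric.mem_closedBall, dist_pi_le_iff hr.le]
    intro α
    rw [Real.dist_eq, add_sub_cancel_left, abs_mul, abs_of_pos hr]
    refine mul_le_of_le_one_right hr.le ?_
    rcases lt_trichotomy (θ α) 0 with h | h | h <;> simp [h]
  have h := le_logPartition_of_mem_meanParamSet hmem θ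
  have hsum : ∑ α : I, θ α * (μ α + r * SignType.sign (θ α)) =
      (∑ α : I, θ α * μ α) + r * ∑ α : I, |θ α| := by
    rw [Finset.mul_sum, ← Finset.sum_add_distrib]
    refine Finset.sum_congr rfl fun α _ => ?_
    rw [← self_mul_sign]
    ring
  have hnorm : ‖θ‖ ≤ ∑ α : I, |θ α| :=
    (pi_norm_le_iff_of_nonneg (Finset.sum_nonneg fun _ _ => abs_nonneg _)).2 fun α =>
      Finset.single_le_sum (f := fun α => |θ α|) (fun _ _ => abs_nonneg _) (Finset.mem_univ α)
  rw [hsum] at h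
  have := mul_le_mul_of_nonneg_left hnorm hr.le
  linarith

theorem continuous_logPartition [Nonempty X] (φ : X → I → ℝ) : Continuous (logPartition φ) := by
  unfold logPartition
  exact Continuous.log (by fun_prop) fun θ => (sum_exp_pos _).ne'

theorem hasDerivAt_logPartition_add_smul_single [Nonempty X] [DecidableEq I] (φ : X → I → ℝ)
    (θ : I → ℝ) (α : I) :
    HasDerivAt (fun t : ℝ => logPartition φ (θ + t • Pi.single α 1)) (forwardMap φ θ α) 0 := by
  have hline : ∀ (t : ℝ) (x : X), ∑ β : I, (θ + t • Pi.single α 1 : I → ℝ) β * φ x β =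
      (∑ β : I, θ β * φ x β) + t * φ x α := by
    intro t x
    simp [add_mul, Finset.sum_add_distrib, Pi.single_apply]
  have hexp : ∀ x : X, HasDerivAt (fun t : ℝ => Real.exp ((∑ β : I, θ β * φ x β) + t * φ x α))
      (Real.exp (∑ β : I, θ β * φ x β) * φ x α) 0 := by
    intro x
    simpa using (((hasDerivAt_id (0 : ℝ)).mul_const (φ x α)).const_add
      (∑ β : I, θ β * φ x β)).exp
  have hlog := (HasDerivAt.fun_sum (u := Finset.univ) fun x _ => hexp x).log (sum_exp_pos _).ne'
  simp only [logPartition, hline]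
  convert hlog using 1
  simp only [forwardMap, expDensity_eq_div, zero_mul, add_zero, Finset.sum_div]
  exact Finset.sum_congr rfl fun _ _ => by ring

theorem interior_meanParamSet_subset_range [Nonempty X] (φ : X → I → ℝ) :
    interior (meanParamSet φ) ⊆ Set.range (forwardMap φ) := by
  classical
  intro μ hμ
  obtain ⟨r, hr, hle⟩ := exists_mul_norm_le_logPartition_sub hμ
  have hcont : Continuous fun θ : I → ℝ => logPartition φ θ - ∑ α : I, θ α * μ α :=
    (continuous_logPartition φ).sub (by fun_prop)
  have htend : Filter.Tendsto (fun θ : I → ℝ => logPartition φ θ - ∑ α : I, θ α * μ α)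
      (Filter.cocompact _) Filter.atTop :=
    Filter.tendsto_atTop_mono hle
      ((tendsto_norm_cocompact_atTop (E := I → ℝ)).const_mul_atTop hr)
  obtain ⟨θ, hθ⟩ := hcont.exists_forall_le htend
  refine ⟨θ, funext fun α => ?_⟩
  have hlin : HasDerivAt (fun t : ℝ => ∑ β : I, (θ + t • Pi.single α 1 : I → ℝ) β * μ β)
      (μ α) 0 := by
    have : (fun t : ℝ => ∑ β : I, (θ + t • Pi.single α 1 : I → ℝ) β * μ β) =
        fun t => (∑ β : I, θ β * μ β) + t * μ α := by
      ext t
      simp [add_mul, Finset.sum_add_distrib, Pi.single_apply]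
    rw [this]
    simpa using ((hasDerivAt_id (0 : ℝ)).mul_const (μ α)).const_add (∑ β : I, θ β * μ β)
  have hderiv := (hasDerivAt_logPartition_add_smul_single φ θ α).fun_sub hlin
  refine sub_eq_zero.1 (IsLocalMin.hasDerivAt_eq_zero (Filter.Eventually.of_forall fun t => ?_)
    hderiv)
  simpa only [zero_smul, add_zero] using hθ (θ + t • Pi.single α 1)

end ExponentialFamily

/-- If the exponential family is minimal, then the forward map
`θ ↦ ∇A(θ) = (E_θ[φ_α(X)])_{α∈I}` is a bijection from `ℝ^I` onto the interior
of the set `M_φ` of realizable mean parameters. -/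
theorem minimal_forwardMap_bijective_onto_interior
    {X I : Type*} [Fintype X] [Nonempty X] [Fintype I]
    (φ : X → I → ℝ) (hmin : MinimalFamily φ) :
    Function.Injective (forwardMap φ) ∧
    Set.range (forwardMap φ) = interior (meanParamSet φ) := by
  exact ⟨hmin.forwardMap_injective,
    hmin.range_forwardMap_subset.antisymm (interior_meanParamSet_subset_range φ)⟩
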